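/- arXiv:2405.06597 — 2 statements merged into one kernel-verified Lean document; each statement's English description precedes it below -/
import Mathlib

section
/- The vector representation matrices of the two-parameter quantum group of type C_n satisfy the cross relations: for all 1 ≤ i, j ≤ n, e_i f_j − f_j e_i = δ_{ij}·(ω_i − ω_i′)/(r_i − s_i), where r_i = r and s_i = s for 1 ≤ i ≤ n−1, and r_n = r², s_n = s². -/
noncomputable section

open Finset
open scoped Kronecker

set_option maxHeartbeats 1000000

abbrev K : Type := FractionRing (MvPolynomial (Fin 2) ℚ)

def ρ : K := algebraMap (MvPolynomial (Fin 2) ℚ) K (MvPolynomial.X 0)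
def σ' : K := algebraMap (MvPolynomial (Fin 2) ℚ) K (MvPolynomial.X 1)
def r : K := ρ ^ 2
def s : K := σ' ^ 2

abbrev M (n : ℕ) := Matrix (Fin (2*n)) (Fin (2*n)) K
abbrev M2 (n : ℕ) := Matrix (Fin (2*n) × Fin (2*n)) (Fin (2*n) × Fin (2*n)) K

/-- the matrix unit `E_{kl}` (1-based indices). -/
def E (n k l : ℕ) : M n :=
  Matrix.of fun a b => if a.val + 1 = k ∧ b.val + 1 = l then (1 : K) else 0

def eMat (n i : ℕ) : M n :=
  if i = n then (ρ⁻¹ * σ'⁻¹) • E n (n+1) n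
  else (ρ⁻¹ * σ'⁻¹) • E n (i+1) i - E n (2*n-i+1) (2*n-i)

def fMat (n i : ℕ) : M n :=
  if i = n then (ρ⁻¹ * σ'⁻¹) • E n n (n+1)
  else (ρ⁻¹ * σ'⁻¹) • E n i (i+1) - E n (2*n-i) (2*n-i+1)

def ωMat (n i : ℕ) : M n :=
  if i = n then
    ∑ j ∈ Icc 1 (2*n),
      (if j ≤ n - 1 then r * s else if j = n then r⁻¹ * s else if j = n + 1 then r * s⁻¹
       else r⁻¹ * s⁻¹) • E n j j
  else
    ∑ j ∈ Icc 1 (2*n),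
      (if j = i then r⁻¹ else if j = i + 1 then s⁻¹ else if j = 2*n - i then s
       else if j = 2*n - i + 1 then r else 1) • E n j j

def ω'Mat (n i : ℕ) : M n :=
  if i = n then
    ∑ j ∈ Icc 1 (2*n),
      (if j ≤ n - 1 then r * s else if j = n then r * s⁻¹ else if j = n + 1 then r⁻¹ * s
       else r⁻¹ * s⁻¹) • E n j j
  else
    ∑ j ∈ Icc 1 (2*n),
      (if j = i then s⁻¹ else if j = i + 1 then r⁻¹ else if j = 2*n - i then r
       else if j = 2*n - i + 1 then s else 1) • E n j j

/-- `(ε_j, α_i)` for the type `C_n` root system (1-based indices). -/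
def ip (n j i : ℕ) : ℤ :=
  if i = n then (if j = n then 2 else 0)
  else (if j = i then 1 else 0) - (if j = i + 1 then 1 else 0)

def rP (n i : ℕ) : K := if i = n then r ^ 2 else r
def sP (n i : ℕ) : K := if i = n then s ^ 2 else s

theorem E_mul_same (n k l m : ℕ) (h1 : 1 ≤ l) (h2 : l ≤ 2*n) :
    E n k l * E n l m = E n k m := by
  ext a b
  rw [Matrix.mul_apply, Finset.sum_eq_single (⟨l - 1, by omega⟩ : Fin (2*n))]
  · have : l - 1 + 1 = l := by omega
    by_cases ha : a.val + 1 = k <;> by_cases hb : b.val + 1 = m <;> simp [E, ha, hb, this]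
  · intro c _ hc
    have : ¬ (c.val + 1 = l) := fun h => hc (Fin.ext (by simp; omega))
    simp [E, this]
  · simp

theorem E_mul_ne (n k l l' m : ℕ) (h : l ≠ l') : E n k l * E n l' m = 0 := by
  ext a b
  rw [Matrix.mul_apply, Finset.sum_eq_zero]
  · simp
  · intro c _
    by_cases hc : c.val + 1 = l
    · have : ¬ (c.val + 1 = l') := by omega
      simp [E, this]
    · simp [E, hc]

theorem diag_apply (n : ℕ) (c : ℕ → K) (a b : Fin (2*n)) :
    (∑ j ∈ Icc 1 (2*n), c j • E n j j) a b = if a = b then c (a.val + 1) else 0 := by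
  rw [Matrix.sum_apply, Finset.sum_eq_single (a.val + 1)]
  · by_cases h : a = b
    · simp [E, h]
    · have : ¬ (b.val = a.val) := fun h' => h (Fin.ext h'.symm)
      simp [E, h, this]
  · intro j _ hj
    have : ¬ (a.val + 1 = j) := fun h => hj h.symm
    simp [E, this]
  · intro h
    exact absurd (Finset.mem_Icc.2 ⟨by omega, by omega⟩) h

theorem E_diag_apply (n k : ℕ) (a b : Fin (2*n)) :
    E n k k a b = if a = b then (if a.val + 1 = k then 1 else 0) else 0 := by
  by_cases h : a = b
  · simp [E, h]
  · have : ¬ (a.val = b.val) := fun h' => h (Fin.ext h')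
    simp only [E, Matrix.of_apply, if_neg h]
    rw [if_neg]
    omega

theorem ρ_ne : ρ ≠ 0 := by
  simp [ρ]

theorem σ_ne : σ' ≠ 0 := by
  simp [σ']

theorem pow_ne (k : ℕ) (hk : k ≠ 0) : ρ ^ k - σ' ^ k ≠ 0 := by
  intro h
  have h2 : (MvPolynomial.X 0 ^ k : MvPolynomial (Fin 2) ℚ) = MvPolynomial.X 1 ^ k := by
    apply IsFractionRing.injective (MvPolynomial (Fin 2) ℚ) K
    rw [map_pow, map_pow]
    exact sub_eq_zero.1 h
  have h3 := congrArg (MvPolynomial.eval (fun i : Fin 2 => if i = 0 then (1:ℚ) else 0)) h2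
  simp [hk] at h3

theorem comm_n (n : ℕ) (hn : 2 ≤ n) :
    eMat n n * fMat n n - fMat n n * eMat n n =
      (rP n n - sP n n)⁻¹ • (ωMat n n - ω'Mat n n) := by
  have h4 := pow_ne 4 (by norm_num)
  have hr := ρ_ne
  have hs := σ_ne
  simp only [eMat, fMat, if_true, smul_mul_assoc, mul_smul_comm]
  rw [E_mul_same _ _ _ _ (by omega) (by omega), E_mul_same _ _ _ _ (by omega) (by omega)]
  ext a b
  simp only [ωMat, ω'Mat, rP, sP, if_true, Matrix.sub_apply, Matrix.smul_apply]
  rw [diag_apply, diag_apply, E_diag_apply, E_diag_apply]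
  by_cases hab : a = b
  swap
  · simp [hab]
  simp only [if_pos hab, smul_eq_mul]
  have e4 : (r ^ 2 - s ^ 2) = ρ ^ 4 - σ' ^ 4 := by simp only [r, s]; ring
  rw [e4]
  generalize a.val + 1 = x
  split_ifs <;> first | omega | (simp only [r, s]; field_simp; ring) | simp

theorem comm_i (n i : ℕ) (hi : 1 ≤ i) (hin : i < n) :
    eMat n i * fMat n i - fMat n i * eMat n i =
      (rP n i - sP n i)⁻¹ • (ωMat n i - ω'Mat n i) := by
  have h4 := pow_ne 2 (by norm_num)
  have hr := ρ_ne
  have hs := σ_ne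
  have hne : i ≠ n := by omega
  simp only [eMat, fMat, if_neg hne, smul_mul_assoc, mul_smul_comm, sub_mul, mul_sub]
  rw [E_mul_same _ _ _ _ (by omega) (by omega), E_mul_same _ _ _ _ (by omega) (by omega),
    E_mul_same _ _ _ _ (by omega) (by omega), E_mul_same _ _ _ _ (by omega) (by omega),
    E_mul_ne _ _ _ _ _ (by omega), E_mul_ne _ _ _ _ _ (by omega),
    E_mul_ne _ _ _ _ _ (by omega), E_mul_ne _ _ _ _ _ (by omega)]
  ext a b
  simp only [ωMat, ω'Mat, rP, sP, if_neg hne, Matrix.sub_apply, Matrix.smul_apply,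
    Matrix.zero_apply]
  rw [diag_apply, diag_apply, E_diag_apply, E_diag_apply, E_diag_apply, E_diag_apply]
  by_cases hab : a = b
  swap
  · simp [hab]
  simp only [if_pos hab, smul_eq_mul]
  generalize a.val + 1 = x
  simp only [r, s]
  split_ifs <;> first | omega | (field_simp; ring) | (field_simp; done) | simp

theorem comm_ne (n i j : ℕ) (hi1 : 1 ≤ i) (hi2 : i ≤ n) (hj1 : 1 ≤ j) (hj2 : j ≤ n)
    (hij : i ≠ j) : eMat n i * fMat n j - fMat n j * eMat n i = 0 := by
  unfold eMat fMat
  split_ifs <;> first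
    | omega
    | (simp only [smul_mul_assoc, mul_smul_comm, sub_mul, mul_sub]
       repeat rw [E_mul_ne _ _ _ _ _ (by omega)]
       simp)

/-- cross relations in the vector representation. -/
theorem stmt0 (n : ℕ) (hn : 2 ≤ n) (i j : ℕ)
    (hi1 : 1 ≤ i) (hi2 : i ≤ n) (hj1 : 1 ≤ j) (hj2 : j ≤ n) :
    eMat n i * fMat n j - fMat n j * eMat n i =
      if i = j then (rP n i - sP n i)⁻¹ • (ωMat n i - ω'Mat n i) else 0 := by
  by_cases hij : i = j
  · subst hij
    rw [if_pos rfl]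
    by_cases h : i = n
    · subst h
      exact comm_n i hn
    · exact comm_i n i hi1 (by omega)
  · rw [if_neg hij]
    exact comm_ne n i j hi1 hi2 hj1 hj2 hij

end
end

section
/- The vector representation matrices of the two-parameter quantum group of type C_n satisfy the Cartan conjugation relations: all the matrices ω_1,…,ω_n, ω_1′,…,ω_n′ are invertible and commute pairwise, and, with α_i = ε_i − ε_{i+1} for 1 ≤ i ≤ n−1, α_n = 2ε_n in ℝⁿ (ε_1,…,ε_n an orthonormal basis, (·,·) the standard inner product): for 1 ≤ j ≤ n−1 and 1 ≤ i ≤ n, ω_j e_i ω_j^{−1} = r^{(ε_j,α_i)}s^{(ε_{j+1},α_i)} e_i and ω_j f_i ω_j^{−1} = r^{−(ε_j,α_i)}s^{−(ε_{j+1},α_i)} f_i, and ω_j′ e_i ω_j′^{−1} = s^{(ε_j,α_i)}r^{(ε_{j+1},α_i)} e_i and ω_j′ f_i ω_j′^{−1} = s^{−(ε_j,α_i)}r^{−(ε_{j+1},α_i)} f_i; for 1 ≤ j ≤ n−1, ω_n e_j ω_n^{−1} = r^{2(ε_n,α_j)} e_j, ω_n f_j ω_n^{−1} = r^{−2(ε_n,α_j)}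 f_j, ω_n′ e_j ω_n′^{−1} = s^{2(ε_n,α_j)} e_j, ω_n′ f_j ω_n′^{−1} = s^{−2(ε_n,α_j)} f_j; and ω_n e_n ω_n^{−1} = r²s^{−2} e_n, ω_n f_n ω_n^{−1} = r^{−2}s² f_n, ω_n′ e_n ω_n′^{−1} = s²r^{−2} e_n, ω_n′ f_n ω_n′^{−1} = s^{−2}r² f_n. -/
noncomputable section

open Finset
open scoped Kronecker

set_option maxHeartbeats 1000000

def WW (n i : ℕ) (a b : K) (j : ℕ) : K :=
  if i = n then
      (if j ≤ n - 1 then a * b else if j = n then a⁻¹ * b else if j = n + 1 then a * b⁻¹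
       else a⁻¹ * b⁻¹)
  else
      (if j = i then a⁻¹ else if j = i + 1 then b⁻¹ else if j = 2*n - i then b
       else if j = 2*n - i + 1 then a else 1)

def DD (n : ℕ) (w : ℕ → K) : M n := Matrix.diagonal fun x => w (x.val + 1)

lemma sum_eq_DD (n : ℕ) (w : ℕ → K) : ∑ j ∈ Icc 1 (2*n), w j • E n j j = DD n w := by
  ext x y
  rw [Matrix.sum_apply]
  simp only [DD, E, Matrix.smul_apply, Matrix.of_apply, Matrix.diagonal_apply, smul_eq_mul]
  by_cases h : x = y
  · subst h
    rw [Finset.sum_eq_single (x.val + 1)]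
    · simp
    · intro b _ hb
      simp [Ne.symm hb]
    · intro h
      exfalso
      apply h
      have := x.isLt
      simp only [Finset.mem_Icc]
      omega
  · rw [if_neg h]
    apply Finset.sum_eq_zero
    intro j _
    have h' : x.val ≠ y.val := fun hh => h (Fin.ext hh)
    rw [if_neg (by omega), mul_zero]

lemma omega_eq (n i : ℕ) : ωMat n i = DD n (WW n i r s) := by
  rw [← sum_eq_DD]
  unfold ωMat WW
  split_ifs <;> rfl

lemma omega'_eq (n i : ℕ) : ω'Mat n i = DD n (WW n i s r) := by
  rw [← sum_eq_DD]
  unfold ω'Mat WW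
  simp only [mul_comm s r, mul_comm s⁻¹ r, mul_comm s r⁻¹, mul_comm s⁻¹ r⁻¹]
  split_ifs <;> rfl

lemma r_ne : r ≠ 0 := by
  unfold r ρ
  apply pow_ne_zero
  rw [Ne, FaithfulSMul.algebraMap_eq_zero_iff]
  exact MvPolynomial.X_ne_zero 0

lemma s_ne : s ≠ 0 := by
  unfold s σ'
  apply pow_ne_zero
  rw [Ne, FaithfulSMul.algebraMap_eq_zero_iff]
  exact MvPolynomial.X_ne_zero 1

lemma WW_ne (n i : ℕ) {a b : K} (ha : a ≠ 0) (hb : b ≠ 0) (j : ℕ) : WW n i a b j ≠ 0 := by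
  unfold WW
  split_ifs <;> simp [ha, hb]

lemma DD_unit (n : ℕ) {w : ℕ → K} (hw : ∀ j, w j ≠ 0) : IsUnit (DD n w) := by
  rw [Matrix.isUnit_iff_isUnit_det, DD, Matrix.det_diagonal, isUnit_iff_ne_zero]
  exact Finset.prod_ne_zero_iff.2 fun _ _ => hw _

lemma DD_comm (n : ℕ) (w v : ℕ → K) : DD n w * DD n v = DD n v * DD n w := by
  simp only [DD, Matrix.diagonal_mul_diagonal, mul_comm]

lemma DD_E (n : ℕ) (w : ℕ → K) (c : K) (k l : ℕ) (h : w k = c * w l) :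
    DD n w * E n k l = c • (E n k l * DD n w) := by
  ext x y
  simp only [DD, E, Matrix.diagonal_mul, Matrix.mul_diagonal, Matrix.smul_apply, Matrix.of_apply,
    smul_eq_mul]
  split_ifs with hh
  · rw [hh.1, hh.2, h]; ring
  · simp

lemma conj_of (n : ℕ) {w : ℕ → K} (hw : ∀ j, w j ≠ 0) (c : K) (X : M n)
    (h : DD n w * X = c • (X * DD n w)) : DD n w * X * (DD n w)⁻¹ = c • X := by
  rw [h, Matrix.smul_mul, Matrix.mul_assoc, Matrix.mul_nonsing_inv, Matrix.mul_one]
  exact (Matrix.isUnit_iff_isUnit_det _).1 (DD_unit n hw)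

/-- The two weight conditions giving both conjugation relations. -/
def Good (n i : ℕ) (w : ℕ → K) (c : K) : Prop :=
  w (i+1) = c * w i ∧ w (2*n-i+1) = c * w (2*n-i)

lemma conj_e (n i : ℕ) {w : ℕ → K} (hw : ∀ j, w j ≠ 0) (c : K) (h : Good n i w c) :
    DD n w * eMat n i * (DD n w)⁻¹ = c • eMat n i := by
  apply conj_of n hw
  unfold eMat
  split_ifs with hi
  · subst hi
    rw [Matrix.mul_smul, DD_E i w c _ _ h.1, Matrix.smul_mul, smul_comm]
  · rw [Matrix.mul_sub, Matrix.mul_smul, DD_E n w c _ _ h.1, DD_E n w c _ _ h.2, Matrix.sub_mul,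
      Matrix.smul_mul, smul_sub, smul_comm]

lemma conj_f (n i : ℕ) {w : ℕ → K} (hw : ∀ j, w j ≠ 0) (c d : K) (h : Good n i w c)
    (hcd : d * c = 1) :
    DD n w * fMat n i * (DD n w)⁻¹ = d • fMat n i := by
  have h1 : w i = d * w (i+1) := by rw [h.1, ← mul_assoc, hcd, one_mul]
  have h2 : w (2*n-i) = d * w (2*n-i+1) := by rw [h.2, ← mul_assoc, hcd, one_mul]
  apply conj_of n hw
  unfold fMat
  split_ifs with hi
  · subst hi
    rw [Matrix.mul_smul, DD_E i w d _ _ h1, Matrix.smul_mul, smul_comm]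
  · rw [Matrix.mul_sub, Matrix.mul_smul, DD_E n w d _ _ h1, DD_E n w d _ _ h2, Matrix.sub_mul,
      Matrix.smul_mul, smul_sub, smul_comm]

lemma good1 (n i j : ℕ) {a b : K} (ha : a ≠ 0) (hb : b ≠ 0) (hj : 1 ≤ j) (hj' : j ≤ n - 1)
    (hi : 1 ≤ i) (hi' : i ≤ n) : Good n i (WW n j a b) (a ^ ip n j i * b ^ ip n (j+1) i) := by
  have hjn : j ≠ n := by omega
  have e0 : ((0:ℤ) - 1) = -1 := by norm_num
  unfold Good WW ip
  simp only [if_neg hjn]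
  constructor <;> split_ifs <;> first
    | (exfalso; omega)
    | (simp [e0, ha, hb, zpow_ofNat] <;> try field_simp)

lemma good2 (n j : ℕ) {a b : K} (ha : a ≠ 0) (hb : b ≠ 0) (hj : 1 ≤ j) (hj' : j ≤ n - 1) :
    Good n j (WW n n a b) (a ^ (2 * ip n n j)) := by
  have hjn : j ≠ n := by omega
  have e0 : (2 * ((0:ℤ) - 1)) = -2 := by norm_num
  have e1 : a ^ (-2 : ℤ) = (a ^ 2)⁻¹ := by rw [zpow_neg]; rfl
  unfold Good WW ip
  simp only [if_neg hjn, if_true]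
  constructor <;> split_ifs <;> first
    | (exfalso; omega)
    | (simp [e0, e1, ha, hb] <;> try field_simp)

lemma good3 (n : ℕ) {a b : K} (ha : a ≠ 0) (hb : b ≠ 0) (hn : 2 ≤ n) :
    Good n n (WW n n a b) (a ^ (2 : ℤ) * b ^ (-2 : ℤ)) := by
  have e1 : b ^ (-2 : ℤ) = (b ^ 2)⁻¹ := by rw [zpow_neg]; rfl
  have e2 : a ^ (2 : ℤ) = a ^ 2 := rfl
  rw [e1, e2]
  unfold Good WW
  simp only [if_true]
  constructor <;> split_ifs <;> first
    | (exfalso; omega)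
    | field_simp

/-- Cartan conjugation relations in the vector representation. -/
theorem stmt1 (n : ℕ) (hn : 2 ≤ n) :
    (∀ i, 1 ≤ i → i ≤ n → IsUnit (ωMat n i) ∧ IsUnit (ω'Mat n i)) ∧
    (∀ i j, 1 ≤ i → i ≤ n → 1 ≤ j → j ≤ n →
      ωMat n i * ωMat n j = ωMat n j * ωMat n i ∧
      ωMat n i * ω'Mat n j = ω'Mat n j * ωMat n i ∧
      ω'Mat n i * ω'Mat n j = ω'Mat n j * ω'Mat n i) ∧
    (∀ j i, 1 ≤ j → j ≤ n - 1 → 1 ≤ i → i ≤ n →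
      ωMat n j * eMat n i * (ωMat n j)⁻¹ = (r ^ ip n j i * s ^ ip n (j+1) i) • eMat n i ∧
      ωMat n j * fMat n i * (ωMat n j)⁻¹
        = (r ^ (-(ip n j i)) * s ^ (-(ip n (j+1) i))) • fMat n i ∧
      ω'Mat n j * eMat n i * (ω'Mat n j)⁻¹ = (s ^ ip n j i * r ^ ip n (j+1) i) • eMat n i ∧
      ω'Mat n j * fMat n i * (ω'Mat n j)⁻¹
        = (s ^ (-(ip n j i)) * r ^ (-(ip n (j+1) i))) • fMat n i) ∧
    (∀ j, 1 ≤ j → j ≤ n - 1 →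
      ωMat n n * eMat n j * (ωMat n n)⁻¹ = (r ^ (2 * ip n n j)) • eMat n j ∧
      ωMat n n * fMat n j * (ωMat n n)⁻¹ = (r ^ (-(2 * ip n n j))) • fMat n j ∧
      ω'Mat n n * eMat n j * (ω'Mat n n)⁻¹ = (s ^ (2 * ip n n j)) • eMat n j ∧
      ω'Mat n n * fMat n j * (ω'Mat n n)⁻¹ = (s ^ (-(2 * ip n n j))) • fMat n j) ∧
    ωMat n n * eMat n n * (ωMat n n)⁻¹ = (r ^ (2 : ℤ) * s ^ (-2 : ℤ)) • eMat n n ∧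
    ωMat n n * fMat n n * (ωMat n n)⁻¹ = (r ^ (-2 : ℤ) * s ^ (2 : ℤ)) • fMat n n ∧
    ω'Mat n n * eMat n n * (ω'Mat n n)⁻¹ = (s ^ (2 : ℤ) * r ^ (-2 : ℤ)) • eMat n n ∧
    ω'Mat n n * fMat n n * (ω'Mat n n)⁻¹ = (s ^ (-2 : ℤ) * r ^ (2 : ℤ)) • fMat n n := by
  have hr := r_ne
  have hs := s_ne
  simp only [omega_eq, omega'_eq]
  have key : ∀ (x y : K) (p q : ℤ), x ≠ 0 → y ≠ 0 →
      (x ^ (-p) * y ^ (-q)) * (x ^ p * y ^ q) = 1 := by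
    intro x y p q hx hy
    rw [mul_mul_mul_comm, ← zpow_add₀ hx, ← zpow_add₀ hy]
    simp
  have key1 : ∀ (x : K) (p : ℤ), x ≠ 0 → x ^ (-p) * x ^ p = 1 := by
    intro x p hx
    rw [← zpow_add₀ hx]
    simp
  have wr := fun i => WW_ne n i hr hs
  have ws := fun i => WW_ne n i hs hr
  refine ⟨fun i _ _ => ⟨DD_unit n (wr i), DD_unit n (ws i)⟩,
    fun i j _ _ _ _ => ⟨DD_comm _ _ _, DD_comm _ _ _, DD_comm _ _ _⟩, ?_, ?_, ?_, ?_, ?_, ?_⟩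
  · intro j i h1 h2 h3 h4
    have g := good1 n i j hr hs h1 h2 h3 h4
    have g' := good1 n i j hs hr h1 h2 h3 h4
    exact ⟨conj_e n i (wr j) _ g, conj_f n i (wr j) _ _ g (key _ _ _ _ hr hs),
      conj_e n i (ws j) _ g', conj_f n i (ws j) _ _ g' (key _ _ _ _ hs hr)⟩
  · intro j h1 h2
    have g := good2 n j hr hs h1 h2
    have g' := good2 n j hs hr h1 h2
    exact ⟨conj_e n j (wr n) _ g, conj_f n j (wr n) _ _ g (key1 _ _ hr),
      conj_e n j (ws n) _ g', conj_f n j (ws n) _ _ g' (key1 _ _ hs)⟩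
  · exact conj_e n n (wr n) _ (good3 n hr hs hn)
  · exact conj_f n n (wr n) _ _ (good3 n hr hs hn) (key r s 2 (-2) hr hs)
  · exact conj_e n n (ws n) _ (good3 n hs hr hn)
  · exact conj_f n n (ws n) _ _ (good3 n hs hr hn) (key s r 2 (-2) hs hr)

end
end
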